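/- arXiv:2009.12059 — 2 statements merged into one kernel-verified Lean document; each statement's English description precedes it below -/
import Mathlib

section
/- For every two signed graphs (G,σ) and (H,π), (G,σ) admits a homomorphism to (H,π) if and only if (G,σ) admits a sign-preserving homomorphism to the double switching graph (Ĥ,π̂) of (H,π). -/
open SimpleGraph

/-- A signed graph: a simple graph together with a symmetric sign function on
ordered pairs of vertices (`true` = positive, `false` = negative); only the values
on adjacent pairs are relevant. -/
structure SignedGraph (V : Type) where
  G : SimpleGraph V
  sign : V → V → Bool
  sign_symm : ∀ u v : V, sign u v = sign v u

namespace SignedGraph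

variable {V W : Type}

/-- The sign of a walk: `true` iff it traverses an even number of negative edges
(counted with multiplicity). -/
def walkSign (S : SignedGraph V) {u v : V} (w : S.G.Walk u v) : Bool :=
  (w.darts.map fun d => S.sign d.toProd.1 d.toProd.2).foldr (· == ·) true

/-- `SwitchEquiv S T` : `T` is obtained from `S` by switching a set of vertices
(encoded by `s : V → Bool`). -/
def SwitchEquiv (S T : SignedGraph V) : Prop :=
  S.G = T.G ∧ ∃ s : V → Bool, ∀ u v : V, S.G.Adj u v →
    T.sign u v = ((s u == s v) == S.sign u v)

/-- A sign-preserving homomorphism. -/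
def IsSpHom (S : SignedGraph V) (T : SignedGraph W) (f : V → W) : Prop :=
  ∀ u v : V, S.G.Adj u v →
    T.G.Adj (f u) (f v) ∧ T.sign (f u) (f v) = S.sign u v

/-- A homomorphism of signed graphs: maps edges to edges and preserves the signs of
closed walks. -/
def IsHom (S : SignedGraph V) (T : SignedGraph W) (f : V → W) : Prop :=
  ∃ hadj : ∀ u v : V, S.G.Adj u v → T.G.Adj (f u) (f v),
    ∀ (u : V) (w : S.G.Walk u u),
      T.walkSign (w.map ⟨f, fun {a b} h => hadj a b h⟩) = S.walkSign w

/-- A sign-preserving isomorphism. -/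
def IsSpIso (S : SignedGraph V) (T : SignedGraph W) (f : V → W) : Prop :=
  Function.Bijective f ∧ IsSpHom S T f ∧
    ∃ g : W → V, Function.LeftInverse g f ∧ Function.RightInverse g f ∧ IsSpHom T S g

/-- An isomorphism of signed graphs. -/
def IsIso (S : SignedGraph V) (T : SignedGraph W) (f : V → W) : Prop :=
  Function.Bijective f ∧ IsHom S T f ∧
    ∃ g : W → V, Function.LeftInverse g f ∧ Function.RightInverse g f ∧ IsHom T S g

/-- The sign-preserving chromatic number. -/
noncomputable def chromSp (S : SignedGraph V) : ℕ :=
  sInf {n : ℕ | ∃ T : SignedGraph (Fin n), ∃ f : V → Fin n, IsSpHom S T f}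

/-- The signed chromatic number. -/
noncomputable def chromS (S : SignedGraph V) : ℕ :=
  sInf {n : ℕ | ∃ T : SignedGraph (Fin n), ∃ f : V → Fin n, IsHom S T f}

/-- The double switching graph of a signed graph. -/
def doubleSwitch (S : SignedGraph V) : SignedGraph (V × Bool) where
  G := { Adj := fun p q => S.G.Adj p.1 q.1
         symm := ⟨fun p q h => S.G.symm.symm p.1 q.1 h⟩
         loopless := ⟨fun p h => S.G.loopless.irrefl p.1 h⟩ }
  sign := fun p q => ((p.2 == q.2) == S.sign p.1 q.1)
  sign_symm := by
    rintro ⟨p1, p2⟩ ⟨q1, q2⟩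
    have := S.sign_symm p1 q1
    cases p2 <;> cases q2 <;> simp [this]

end SignedGraph

/-- `G` has a complete minor on `n` branch sets: there are `n` nonempty, pairwise
disjoint vertex sets, each inducing a connected subgraph, with an edge of `G`
between any two of them. -/
def SimpleGraph.HasCompleteMinor {V : Type} (G : SimpleGraph V) (n : ℕ) : Prop :=
  ∃ B : Fin n → Set V,
    (∀ i, (B i).Nonempty) ∧
    (∀ i, (G.induce (B i)).Connected) ∧
    (∀ i j, i ≠ j → Disjoint (B i) (B j)) ∧
    (∀ i j, i ≠ j → ∃ u ∈ B i, ∃ v ∈ B j, G.Adj u v)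



namespace SignedGraph

theorem walkSign_nil' {V : Type} (S : SignedGraph V) (u : V) :
    S.walkSign (SimpleGraph.Walk.nil : S.G.Walk u u) = true := rfl

theorem walkSign_cons' {V : Type} (S : SignedGraph V) {u v w : V} (h : S.G.Adj u v)
    (p : S.G.Walk v w) :
    S.walkSign (SimpleGraph.Walk.cons h p) = (S.sign u v == S.walkSign p) := rfl

theorem walkSign_append' {V : Type} (S : SignedGraph V) {u v w : V} (p : S.G.Walk u v)
    (q : S.G.Walk v w) :
    S.walkSign (p.append q) = (S.walkSign p == S.walkSign q) := by
  induction p with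
  | nil => simp [walkSign_nil']
  | cons h p ih =>
    rw [SimpleGraph.Walk.cons_append, walkSign_cons', walkSign_cons', ih]
    generalize S.walkSign p = a
    generalize S.walkSign q = b
    generalize S.sign _ _ = c
    revert a b c; decide

theorem walkSign_reverse' {V : Type} (S : SignedGraph V) {u v : V} (p : S.G.Walk u v) :
    S.walkSign p.reverse = S.walkSign p := by
  induction p with
  | nil => rfl
  | cons h p ih =>
    rw [SimpleGraph.Walk.reverse_cons, walkSign_append', ih, walkSign_cons', walkSign_cons',
      walkSign_nil', S.sign_symm]
    generalize S.walkSign p = a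
    generalize S.sign _ _ = c
    revert a c; decide

/-- Two parallel walks have the same sign change under a homomorphism. -/
theorem ratio_eq {V W : Type} (S : SignedGraph V) (T : SignedGraph W) (φ : S.G →g T.G)
    (hφ : ∀ (u : V) (w : S.G.Walk u u), T.walkSign (w.map φ) = S.walkSign w)
    {u v : V} (p q : S.G.Walk u v) :
    (T.walkSign (p.map φ) == S.walkSign p) = (T.walkSign (q.map φ) == S.walkSign q) := by
  have h := hφ u (p.append q.reverse)
  rw [SimpleGraph.Walk.map_append, walkSign_append', walkSign_append',
    ← SimpleGraph.Walk.reverse_map, walkSign_reverse', walkSign_reverse'] at h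
  revert h
  generalize S.walkSign p = a
  generalize S.walkSign q = b
  generalize T.walkSign (p.map φ) = c
  generalize T.walkSign (q.map φ) = d
  revert a b c d; decide

theorem exists_switch {V W : Type} (S : SignedGraph V) (T : SignedGraph W) (φ : S.G →g T.G)
    (hφ : ∀ (u : V) (w : S.G.Walk u u), T.walkSign (w.map φ) = S.walkSign w) :
    ∃ s : V → Bool, ∀ u v, S.G.Adj u v →
      ((s u == s v) == T.sign (φ u) (φ v)) = S.sign u v := by
  classical
  let r : V → V := fun v => (S.G.connectedComponentMk v).out
  have hr : ∀ v, S.G.Reachable (r v) v := fun v =>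
    SimpleGraph.ConnectedComponent.exact (Quot.out_eq (S.G.connectedComponentMk v))
  have hre : ∀ u v, S.G.Adj u v → r u = r v := fun u v h => by
    have : S.G.connectedComponentMk u = S.G.connectedComponentMk v :=
      SimpleGraph.ConnectedComponent.sound h.reachable
    simp only [r, this]
  let s : V → Bool := fun v =>
    (T.walkSign ((hr v).some.map φ) == S.walkSign (hr v).some)
  have hs : ∀ a v (p : S.G.Walk a v), a = r v →
      s v = (T.walkSign (p.map φ) == S.walkSign p) := by
    rintro a v p rfl
    exact ratio_eq S T φ hφ _ _
  refine ⟨s, fun u v h => ?_⟩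
  have h1 := hs (r u) u (hr u).some rfl
  have h2 := hs (r u) v ((hr u).some.append (SimpleGraph.Walk.cons h SimpleGraph.Walk.nil))
    (hre u v h)
  rw [h1, h2]
  rw [SimpleGraph.Walk.map_append, walkSign_append', walkSign_append',
    SimpleGraph.Walk.map_cons, SimpleGraph.Walk.map_nil, walkSign_cons', walkSign_cons',
    walkSign_nil', walkSign_nil']
  generalize S.walkSign (hr u).some = a
  generalize T.walkSign ((hr u).some.map φ) = b
  generalize T.sign (φ u) (φ v) = c
  generalize S.sign u v = d
  revert a b c d; decide

theorem walkSign_map_switch {V W : Type} (S : SignedGraph V) (T : SignedGraph W)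
    (φ : S.G →g T.G) (s : V → Bool)
    (hs : ∀ u v, S.G.Adj u v → ((s u == s v) == T.sign (φ u) (φ v)) = S.sign u v)
    {u v : V} (p : S.G.Walk u v) :
    T.walkSign (p.map φ) = ((s u == s v) == S.walkSign p) := by
  induction p with
  | nil => simp [walkSign_nil']
  | @cons u v w h p ih =>
    rw [SimpleGraph.Walk.map_cons, walkSign_cons', walkSign_cons', ih, ← hs _ _ h]
    generalize S.walkSign p = a
    generalize T.sign (φ u) (φ v) = c
    generalize s u = x
    generalize s v = y
    generalize s w = z
    revert a c x y z; decide

end SignedGraph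

open SignedGraph in
/-- `(G,σ)` admits a homomorphism to `(H,π)` iff `(G,σ)` admits a sign-preserving
homomorphism to the double switching graph `(Ĥ,π̂)`. -/
theorem exists_isHom_iff_exists_isSpHom_doubleSwitch {V W : Type} [Fintype V] [Fintype W]
    (S : SignedGraph V) (T : SignedGraph W) :
    (∃ f : V → W, IsHom S T f) ↔
      (∃ g : V → W × Bool, IsSpHom S (doubleSwitch T) g) := by
  constructor
  · rintro ⟨f, hadj, hf⟩
    obtain ⟨s, hs⟩ := exists_switch S T ⟨f, fun {a b} h => hadj a b h⟩ hf
    exact ⟨fun v => (f v, s v), fun u v h => ⟨hadj u v h, hs u v h⟩⟩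
  · rintro ⟨g, hg⟩
    refine ⟨fun v => (g v).1, fun u v h => (hg u v h).1, fun u w => ?_⟩
    have key := walkSign_map_switch S T
      ⟨fun v => (g v).1, fun {a b} h => (hg a b h).1⟩ (fun v => (g v).2)
      (fun u v h => (hg u v h).2) w
    refine key.trans ?_
    simp
end

section
/- Let (G,σ) be a signed graph, and let (G*,σ*) be the signed graph obtained from two disjoint copies (G₁,σ₁) and (G₂,σ₂) of (G,σ) by adding a new vertex ∞ joined to every vertex of G₁ by a positive edge and to every vertex of G₂ by a negative edge. Then χ_sp((G*,σ*)) = 2·χ_sp((G,σ)) + 1. -/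
open SimpleGraph

namespace SignedGraph

/-- The signed graph `(G*, σ*)`: two disjoint copies of `(G, σ)` plus a new vertex
`∞` (here `none`) joined to every vertex of the first copy by a positive edge and
to every vertex of the second copy by a negative edge. -/
def starGraph {V : Type} (S : SignedGraph V) : SignedGraph (Option (V ⊕ V)) where
  G := { Adj := fun x y =>
           match x, y with
           | none, none => False
           | none, some _ => True
           | some _, none => True
           | some (Sum.inl u), some (Sum.inl v) => S.G.Adj u v
           | some (Sum.inr u), some (Sum.inr v) => S.G.Adj u v
           | some (Sum.inl _), some (Sum.inr _) => False
           | some (Sum.inr _), some (Sum.inl _) => False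
         symm := by
           refine ⟨?_⟩
           rintro (_ | (u | u)) (_ | (v | v)) h <;>
             first | trivial | exact S.G.symm.symm _ _ h
         loopless := by
           refine ⟨?_⟩
           rintro (_ | (u | u)) h <;>
             first | trivial | exact S.G.loopless.irrefl _ h }
  sign := fun x y =>
    match x, y with
    | some (Sum.inl u), some (Sum.inl v) => S.sign u v
    | some (Sum.inr u), some (Sum.inr v) => S.sign u v
    | none, some (Sum.inl _) => true
    | some (Sum.inl _), none => true
    | none, some (Sum.inr _) => false
    | some (Sum.inr _), none => false
    | _, _ => true
  sign_symm := by
    rintro (_ | (u | u)) (_ | (v | v)) <;>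
      first | rfl | exact S.sign_symm _ _

end SignedGraph


namespace SignedGraph

/-- Pull back a signed graph along an injective map. -/
def pull {W X : Type} (T : SignedGraph W) (e : X → W) : SignedGraph X where
  G := T.G.comap e
  sign := fun a b => T.sign (e a) (e b)
  sign_symm := fun _ _ => T.sign_symm _ _

theorem chromSp_le_card {V W : Type} (S : SignedGraph V) (T : SignedGraph W) (f : V → W)
    (hf : IsSpHom S T f) (A : Finset W) (hA : ∀ v, f v ∈ A) : chromSp S ≤ A.card := by
  classical
  apply Nat.sInf_le
  let e := A.equivFin
  refine ⟨pull T (fun i => (e.symm i : W)), fun v => e ⟨f v, hA v⟩, ?_⟩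
  intro u v huv
  simpa [pull] using hf u v huv

theorem exists_chromSp {V : Type} [Fintype V] (S : SignedGraph V) :
    ∃ T : SignedGraph (Fin (chromSp S)), ∃ f : V → Fin (chromSp S), IsSpHom S T f := by
  classical
  have hne : {n : ℕ | ∃ T : SignedGraph (Fin n), ∃ f : V → Fin n, IsSpHom S T f}.Nonempty := by
    let e := Fintype.equivFin V
    refine ⟨Fintype.card V, pull S e.symm, e, ?_⟩
    intro u v huv
    simpa [pull] using huv
  exact Nat.sInf_mem hne

end SignedGraph

open SignedGraph in
/-- `χ_sp((G*,σ*)) = 2 χ_sp((G,σ)) + 1`. -/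
theorem chromSp_starGraph {V : Type} [Fintype V] (S : SignedGraph V) :
    chromSp (starGraph S) = 2 * chromSp S + 1 := by
  classical
  apply le_antisymm
  · obtain ⟨T, f, hf⟩ := exists_chromSp S
    have h := chromSp_le_card (starGraph S) (starGraph T) (Option.map (Sum.map f f)) ?_
      Finset.univ (fun _ => Finset.mem_univ _)
    · simp only [Finset.card_univ, Fintype.card_option, Fintype.card_sum, Fintype.card_fin] at h
      omega
    · rintro (_ | (u | u)) (_ | (v | v)) h
      all_goals first
        | exact hf u v h
        | exact ⟨trivial, rfl⟩
        | exact h.elim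
  · obtain ⟨T, f, hf⟩ := exists_chromSp (starGraph S)
    have h1 := chromSp_le_card S T (fun v => f (some (Sum.inl v)))
      (fun u v h => hf (some (Sum.inl u)) (some (Sum.inl v)) h)
      (Finset.univ.image fun v => f (some (Sum.inl v))) (fun v => by simp)
    have h2 := chromSp_le_card S T (fun v => f (some (Sum.inr v)))
      (fun u v h => hf (some (Sum.inr u)) (some (Sum.inr v)) h)
      (Finset.univ.image fun v => f (some (Sum.inr v))) (fun v => by simp)
    set A := Finset.univ.image fun v => f (some (Sum.inl v)) with hA
    set B := Finset.univ.image fun v => f (some (Sum.inr v)) with hB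
    have hdis : Disjoint A B := by
      rw [Finset.disjoint_left]
      intro x hx hy
      simp only [hA, hB, Finset.mem_image, Finset.mem_univ, true_and] at hx hy
      obtain ⟨u, rfl⟩ := hx
      obtain ⟨v, hv⟩ := hy
      have e1 : T.sign (f none) (f (some (Sum.inl u))) = true :=
        (hf none (some (Sum.inl u)) trivial).2
      have e2 : T.sign (f none) (f (some (Sum.inr v))) = false :=
        (hf none (some (Sum.inr v)) trivial).2
      rw [hv, e1] at e2
      exact Bool.noConfusion e2
    have hc : f none ∉ A ∪ B := by
      intro hx
      simp only [hA, hB, Finset.mem_union, Finset.mem_image, Finset.mem_univ, true_and] at hx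
      rcases hx with ⟨u, hu⟩ | ⟨u, hu⟩
      · exact (hf none (some (Sum.inl u)) trivial).1.ne hu.symm
      · exact (hf none (some (Sum.inr u)) trivial).1.ne hu.symm
    have h3 := Finset.card_le_univ (insert (f none) (A ∪ B))
    rw [Finset.card_insert_of_notMem hc, Finset.card_union_of_disjoint hdis,
      Fintype.card_fin] at h3
    omega
end
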